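/- Let P be a finite poset and let L be the set of all lower sets (order ideals) of P, partially ordered by inclusion. Let Z be the square matrix over ℚ with rows and columns indexed by L defined by Z_{I,J} = 1 if I ⊆ J and Z_{I,J} = 0 otherwise, let C := -Z⁻¹ · Zᵀ, and let ρ denote the permutation matrix of the rowmotion bijection of L (with ρ_{J,I} = 1 if J = ρ(I), else 0). Then C · ρᵀ · C = ρ; equivalently, for every antichain S of P, applying C, then ρᵀ, then C to the standard basis vector e_{I(S)} yields the standard basis vector e_{M(S)}. -/

import Mathlib

attribute [local instance] Classical.propDecidable

open Matrix

variable {P : Type*}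

/-- The upper closure of a subset `S` of a poset: all elements above some element of `S`. -/
def upClosure [PartialOrder P] (S : Set P) : Set P := {x | ∃ s ∈ S, s ≤ x}

/-- The set of maximal elements of a subset `I` of a poset. -/
def maxElts [PartialOrder P] (I : Set P) : Set P := {a ∈ I | ∀ b ∈ I, ¬ a < b}

/-- Rowmotion of a set: the complement of the upper closure of its set of maximal elements. -/
def rowmo [PartialOrder P] (I : Set P) : Set P := (upClosure (maxElts I))ᶜ

lemma isLowerSet_upClosure_compl [PartialOrder P] (S : Set P) :
    IsLowerSet (upClosure S)ᶜ := by
  intro a b hba ha hb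
  obtain ⟨s, hs, hle⟩ := hb
  exact ha ⟨s, hs, hle.trans hba⟩

/-- The distributive lattice of lower sets (order ideals) of `P`, ordered by inclusion. -/
abbrev LSet (P : Type*) [PartialOrder P] := {I : Set P // IsLowerSet I}

/-- The rowmotion bijection on the lattice of lower sets. -/
def rowmoL [PartialOrder P] (I : LSet P) : LSet P :=
  ⟨rowmo I.1, isLowerSet_upClosure_compl _⟩

/-- The finset of maximal elements of a lower set. -/
noncomputable def mxF [PartialOrder P] [Fintype P] (K : LSet P) : Finset P :=
  Finset.univ.filter (fun x => x ∈ maxElts K.1)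

lemma mem_mxF [PartialOrder P] [Fintype P] (K : LSet P) (x : P) :
    x ∈ mxF K ↔ x ∈ maxElts K.1 := by simp [mxF]

lemma exists_mx [PartialOrder P] [Fintype P] (K : LSet P) {x : P} (hx : x ∈ K.1) :
    ∃ y ∈ mxF K, x ≤ y := by
  obtain ⟨y, hxy, hy⟩ := (Set.toFinite K.1).exists_le_maximal hx
  refine ⟨y, (mem_mxF K y).2 ⟨hy.prop, fun b hb hlt => ?_⟩, hxy⟩
  exact hlt.not_ge (hy.le_of_ge hb hlt.le)

lemma mxF_sub_iff [PartialOrder P] [Fintype P] (I J : LSet P) :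
    (∀ x ∈ mxF J, x ∈ I.1) ↔ J.1 ⊆ I.1 := by
  constructor
  · intro h x hx
    obtain ⟨y, hy, hxy⟩ := exists_mx J hx
    exact I.2 hxy (h y hy)
  · intro h x hx
    exact h ((mem_mxF J x).1 hx).1

lemma mxF_inj [PartialOrder P] [Fintype P] {I J : LSet P} (h : mxF I = mxF J) : I = J := by
  apply Subtype.ext
  apply Set.Subset.antisymm
  · rw [← mxF_sub_iff, h, mxF_sub_iff]
  · rw [← mxF_sub_iff, ← h, mxF_sub_iff]

lemma exists_of_sub [PartialOrder P] [Fintype P] (J : LSet P) (T : Finset P)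
    (hT : T ⊆ mxF J) : ∃ K : LSet P, mxF K = T := by
  have hanti : ∀ a ∈ T, ∀ b ∈ T, ¬ a < b := fun a ha b hb =>
    ((mem_mxF J a).1 (hT ha)).2 b ((mem_mxF J b).1 (hT hb)).1
  refine ⟨⟨{x | ∃ t ∈ T, x ≤ t}, ?_⟩, ?_⟩
  · rintro a b hba ⟨t, ht, hat⟩
    exact ⟨t, ht, hba.trans hat⟩
  · ext x
    rw [mem_mxF]
    constructor
    · rintro ⟨⟨t, ht, hxt⟩, hmax⟩
      rcases hxt.eq_or_lt with h | h
      · exact h ▸ ht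
      · exact absurd h (hmax t ⟨t, ht, le_rfl⟩)
    · intro hx
      refine ⟨⟨x, hx, le_rfl⟩, ?_⟩
      rintro b ⟨t, ht, hbt⟩ hlt
      exact hanti x hx t ht (hlt.trans_le hbt)

lemma sum_mxF [PartialOrder P] [Fintype P] (J : LSet P) (f : Finset P → ℚ) :
    ∑ K : LSet P, (if mxF K ⊆ mxF J then f (mxF K) else 0) = ∑ T ∈ (mxF J).powerset, f T := by
  rw [← Finset.sum_filter]
  refine Finset.sum_bij (fun K _ => mxF K) ?_ ?_ ?_ ?_
  · intro K hK
    simpa using hK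
  · intro K _ K' _ h
    exact mxF_inj h
  · intro T hT
    have hT' := Finset.mem_powerset.1 hT
    obtain ⟨K, rfl⟩ := exists_of_sub J T hT'
    exact ⟨K, by simpa using hT', rfl⟩
  · intros
    rfl

lemma sub_rowmo [PartialOrder P] [Fintype P] (I K : LSet P) :
    I.1 ⊆ (rowmoL K).1 ↔ ∀ x ∈ mxF K, x ∉ I.1 := by
  constructor
  · intro h x hx hxI
    exact h hxI ⟨x, (mem_mxF K x).1 hx, le_rfl⟩
  · rintro h x hx ⟨s, hs, hsx⟩
    exact h s ((mem_mxF K s).2 hs) (I.2 hsx hx)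

lemma rowmoL_inj [PartialOrder P] [Fintype P] {I J : LSet P} (h : rowmoL I = rowmoL J) :
    I = J := by
  have hu : upClosure (maxElts I.1) = upClosure (maxElts J.1) :=
    compl_injective (congrArg Subtype.val h)
  have key : ∀ I J : LSet P, upClosure (maxElts I.1) = upClosure (maxElts J.1) →
      mxF I ⊆ mxF J := by
    intro I J hu x hx
    rw [mem_mxF] at hx ⊢
    have h1 : x ∈ upClosure (maxElts J.1) := hu ▸ ⟨x, hx, le_rfl⟩
    obtain ⟨s, hs, hsx⟩ := h1
    have h2 : s ∈ upClosure (maxElts I.1) := hu ▸ ⟨s, hs, le_rfl⟩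
    obtain ⟨t, ht, hts⟩ := h2
    have htx : t = x := by
      rcases (hts.trans hsx).eq_or_lt with h | h
      · exact h
      · exact absurd h (ht.2 x hx.1)
    have : s = x := le_antisymm hsx (htx ▸ hts)
    exact this ▸ hs
  exact mxF_inj (Finset.Subset.antisymm (key I J hu) (key J I hu.symm))

lemma alt_sum_disj (A : Finset P) (I : Set P) :
    ∑ T ∈ A.powerset, (if ∀ x ∈ T, x ∉ I then (-1 : ℚ) ^ T.card else 0)
      = if ∀ x ∈ A, x ∈ I then 1 else 0 := by
  have h := Finset.prod_add (fun x => if x ∉ I then (-1 : ℚ) else 0) (fun _ => 1) A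
  simp only [Finset.prod_ite_zero, Finset.prod_const, one_pow, mul_one] at h
  rw [← h]
  have : ∀ x ∈ A, ((if x ∉ I then (-1 : ℚ) else 0) + 1) = if x ∈ I then 1 else 0 := by
    intro x _
    by_cases hx : x ∈ I <;> simp [hx]
  rw [Finset.prod_congr rfl this, Finset.prod_ite_zero]
  simp

lemma alt_sum_sub (A S : Finset P) (hS : S ⊆ A) :
    ∑ T ∈ A.powerset, (if S ⊆ T then (-1 : ℚ) ^ T.card else 0)
      = if A ⊆ S then (-1) ^ A.card else 0 := by
  have h := Finset.prod_add (fun _ => (-1 : ℚ)) (fun x => if x ∉ S then 1 else 0) A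
  simp only [Finset.prod_ite_zero, Finset.prod_const] at h
  have h1 : ∀ x ∈ A, ((-1 : ℚ) + if x ∉ S then 1 else 0) = if x ∈ S then -1 else 0 := by
    intro x _
    by_cases hx : x ∈ S <;> simp [hx]
  rw [Finset.prod_congr rfl h1, Finset.prod_ite_zero, Finset.prod_const] at h
  have h2 : (if A ⊆ S then (-1 : ℚ) ^ A.card else 0)
      = if ∀ x ∈ A, x ∈ S then (-1 : ℚ) ^ A.card else 0 := rfl
  refine Eq.trans ?_ (h.symm.trans ?_)
  · refine Finset.sum_congr rfl fun T _ => ?_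
    have h3 : S ⊆ T ↔ ∀ i ∈ A \ T, i ∉ S := by
      constructor
      · intro hST i hi hiS
        exact (Finset.mem_sdiff.1 hi).2 (hST hiS)
      · intro hh i hi
        by_contra hiT
        exact hh i (Finset.mem_sdiff.2 ⟨hS hi, hiT⟩) hi
    by_cases hST : S ⊆ T
    · rw [if_pos hST, if_pos (h3.1 hST)]; simp
    · rw [if_neg hST, if_neg (fun hh => hST (h3.2 hh))]; simp
  · by_cases hAS : A ⊆ S
    · rw [if_pos hAS, if_pos (fun x hx => hAS hx)]
    · rw [if_neg hAS, if_neg (fun hh => hAS (fun x hx => hh x hx))]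

theorem coxeter_rowmotion_conjugate [PartialOrder P] [Fintype P]
    (Z C ρ : Matrix (LSet P) (LSet P) ℚ)
    (hZ : ∀ I J : LSet P, Z I J = if I.1 ⊆ J.1 then 1 else 0)
    (hC : C = -(Z⁻¹ * Zᵀ))
    (hρ : ∀ J I : LSet P, ρ J I = if J = rowmoL I then 1 else 0) :
    C * ρᵀ * C = ρ := by
  obtain ⟨B, hB⟩ : ∃ B : Matrix (LSet P) (LSet P) ℚ,
      ∀ S T, B S T = if mxF S ⊆ mxF T then (-1) ^ (mxF S).card else 0 :=
    ⟨fun S T => if mxF S ⊆ mxF T then (-1) ^ (mxF S).card else 0, fun _ _ => rfl⟩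
  have hZρ : ∀ I K, (Z * ρ) I K = if ∀ x ∈ mxF K, x ∉ I.1 then 1 else 0 := by
    intro I K
    simp only [Matrix.mul_apply, hρ, mul_ite, mul_one, mul_zero, Finset.sum_ite_eq',
      Finset.sum_ite_eq, Finset.mem_univ, if_true, hZ, sub_rowmo]
  have hZρB : Z * ρ * B = Zᵀ := by
    ext I J
    rw [Matrix.mul_apply, Matrix.transpose_apply, hZ]
    have h0 := alt_sum_disj (mxF J) I.1
    simp only [mxF_sub_iff I J] at h0
    refine Eq.trans ?_ h0
    rw [← sum_mxF]
    refine Finset.sum_congr rfl fun K _ => ?_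
    rw [hZρ, hB]
    split_ifs <;> simp
  have hBB : B * B = 1 := by
    ext S T
    rw [Matrix.mul_apply, Matrix.one_apply]
    have h1 : ∀ K, B S K * B K T = if mxF K ⊆ mxF T then
        (-1) ^ (mxF S).card * (if mxF S ⊆ mxF K then (-1) ^ (mxF K).card else 0) else 0 := by
      intro K
      rw [hB, hB]
      split_ifs <;> simp
    simp only [h1]
    rw [sum_mxF T (fun R => (-1) ^ (mxF S).card *
      (if mxF S ⊆ R then (-1) ^ R.card else 0)), ← Finset.mul_sum]
    by_cases hST : mxF S ⊆ mxF T
    · rw [alt_sum_sub _ _ hST]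
      by_cases hTS : mxF T ⊆ mxF S
      · have := mxF_inj (Finset.Subset.antisymm hST hTS)
        subst this
        simp [← mul_pow]
      · rw [if_neg hTS, if_neg (fun h => hTS (by rw [h])), mul_zero]
    · rw [if_neg (fun h => hST (by rw [h])), Finset.sum_eq_zero, mul_zero]
      intro R hR
      rw [if_neg (fun h => hST (h.trans (Finset.mem_powerset.1 hR)))]
  have hρρ : ρᵀ * ρ = 1 := by
    ext I J
    simp only [Matrix.mul_apply, Matrix.transpose_apply, hρ, Matrix.one_apply, mul_ite, mul_one,
      mul_zero, Finset.sum_ite_eq', Finset.sum_ite_eq, Finset.mem_univ, if_true]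
    by_cases h : I = J
    · simp [h]
    · rw [if_neg h, if_neg (fun hh => h (rowmoL_inj hh.symm))]
  have hZu : IsUnit Z := by
    rw [← Matrix.mulVec_injective_iff_isUnit]
    rw [← Matrix.coe_mulVecLin, ← LinearMap.ker_eq_bot, LinearMap.ker_eq_bot']
    intro v hv
    by_contra hne
    obtain ⟨K0, hK0⟩ := Function.ne_iff.1 hne
    obtain ⟨K, -, hK⟩ := (Set.toFinite {K : LSet P | v K ≠ 0}).exists_le_maximal
      (a := K0) hK0
    have h1 : (Z *ᵥ v) K = 0 := congrFun hv K
    rw [Matrix.mulVec, dotProduct, Finset.sum_eq_single K] at h1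
    · apply hK.prop
      simpa [hZ] using h1
    · intro J _ hJK
      rw [hZ]
      split_ifs with hs
      · by_contra hvJ
        have hvJ' : v J ≠ 0 := by simpa using hvJ
        exact hJK (le_antisymm (hK.le_of_ge hvJ' hs) hs)
      · simp
    · simp
  have hD : Z⁻¹ * Zᵀ = ρ * B := by
    rw [← hZρB, Matrix.mul_assoc, ← Matrix.mul_assoc Z⁻¹,
      Matrix.nonsing_inv_mul _ ((Matrix.isUnit_iff_isUnit_det _).1 hZu), Matrix.one_mul]
  rw [hC, hD]
  calc -(ρ * B) * ρᵀ * -(ρ * B) = ρ * B * (ρᵀ * ρ) * B := by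
        simp only [Matrix.neg_mul, Matrix.mul_neg, neg_neg, Matrix.mul_assoc]
    _ = ρ := by rw [hρρ, Matrix.mul_one, Matrix.mul_assoc, hBB, Matrix.mul_one]
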